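/- Let n ∈ ℕ, k ∈ {0,…,n}, Δ ≥ 0, x ∈ k𝔹₀, w ∈ ℝⁿ, and set C := k𝔹₀ ∩ (x + Δ𝔹∞). Let L := ℓ(x) = {i : |x_i| > Δ}, ŷ_i := max(x_i − Δ, min(w_i, x_i + Δ)), and z_i := w_i² − (w_i − ŷ_i)². Let S be the union of L with a set of indices of k − |L| largest values among {z_i : i ∉ L}, and define p by p_i = ŷ_i for i ∈ S and p_i = 0 for i ∉ S. Then p is a projection of w into C, i.e., p ∈ argmin{‖w − y‖₂ : y ∈ C}. (This is the correctness of Algorithm 1, which runs in O(n log n) operations.) -/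

import Mathlib

open Finset

noncomputable section

/-- The `ℓ∞` ball of radius `Δ` centered at `x`: `x + Δ𝔹∞`. -/
def box (n : ℕ) (x : Fin n → ℝ) (Δ : ℝ) : Set (Fin n → ℝ) :=
  {y | ∀ i, |y i - x i| ≤ Δ}

/-- The zero-norm ball `k𝔹₀`: vectors with at most `k` nonzero components. -/
def sparse (n k : ℕ) : Set (Fin n → ℝ) :=
  {y | (Finset.univ.filter (fun i => y i ≠ 0)).card ≤ k}

/-- The piece `A_S`: vectors supported in `S`. -/
def AS {n : ℕ} (S : Finset (Fin n)) : Set (Fin n → ℝ) :=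
  {y | ∀ i, i ∉ S → y i = 0}

/-- Squared Euclidean distance. -/
def distSq {n : ℕ} (w y : Fin n → ℝ) : ℝ := ∑ i, (w i - y i) ^ 2

/-- The set of projections (closest points in the Euclidean norm) of `w` into `A`. -/
def projSet {n : ℕ} (w : Fin n → ℝ) (A : Set (Fin n → ℝ)) : Set (Fin n → ℝ) :=
  {y | y ∈ A ∧ ∀ z ∈ A, distSq w y ≤ distSq w z}

/-- If `f` is nonnegative on `A` and `B`, every value of `f` on `A` is at most every value of `f` on `B`,
and `B` has at least as many elements as `A`, then the sum of `f` over `A` is at most that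
over `B`. -/
lemma sum_le_sum_of_card_le_of_forall_le {ι : Type*} {A B : Finset ι} {f : ι → ℝ}
    (hcard : A.card ≤ B.card) (hA : ∀ a ∈ A, 0 ≤ f a) (hB : ∀ b ∈ B, 0 ≤ f b)
    (hle : ∀ a ∈ A, ∀ b ∈ B, f a ≤ f b) : ∑ a ∈ A, f a ≤ ∑ b ∈ B, f b := by
  rcases A.eq_empty_or_nonempty with rfl | hne
  · simpa using Finset.sum_nonneg hB
  · obtain ⟨m, hm, hmax⟩ := A.exists_max_image f hne
    calc ∑ a ∈ A, f a ≤ A.card • f m := Finset.sum_le_card_nsmul A f _ hmax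
      _ ≤ B.card • f m := nsmul_le_nsmul_left (hA m hm) hcard
      _ ≤ ∑ b ∈ B, f b := Finset.card_nsmul_le_sum B f _ (hle m hm)

/-- Clamping `w` to `[x - Δ, x + Δ]` gives a point of that interval. -/
lemma abs_clamp_sub_le {x w Δ : ℝ} (hΔ : 0 ≤ Δ) :
    |max (x - Δ) (min w (x + Δ)) - x| ≤ Δ := by
  rw [abs_le]
  constructor
  · linarith [le_max_left (x - Δ) (min w (x + Δ))]
  · have : max (x - Δ) (min w (x + Δ)) ≤ x + Δ := max_le (by linarith) (min_le_right _ _)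
    linarith

/-- The clamp of `w` to `[x - Δ, x + Δ]` is the point of that interval closest to `w`. -/
lemma sq_sub_clamp_le {x w y Δ : ℝ} (hy : |y - x| ≤ Δ) :
    (w - max (x - Δ) (min w (x + Δ))) ^ 2 ≤ (w - y) ^ 2 := by
  obtain ⟨h₁, h₂⟩ := abs_le.1 hy
  rw [sq_le_sq]
  rcases le_total w (x + Δ) with h | h
  · rw [min_eq_left h]
    rcases le_total (x - Δ) w with h' | h'
    · simp [max_eq_right h']
    · rw [max_eq_left h', abs_of_nonpos (by linarith), abs_of_nonpos (by linarith)]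
      linarith
  · rw [min_eq_right h, max_eq_right (by linarith), abs_of_nonneg (by linarith),
      abs_of_nonneg (by linarith)]
    linarith

/-- correctness of Algorithm 1: with `L = ℓ(x) = {i : |x i| > Δ}`, `T` a set
of `k − |L|` indices of largest values of `z` outside `L`, `S = L ∪ T`, and `p` equal to the
clamp `ŷ` on `S` and zero off `S`, the vector `p` is a projection of `w` into
`C = k𝔹₀ ∩ (x + Δ𝔹∞)`. -/
theorem stmt12 (n k : ℕ) (hkn : k ≤ n) (Δ : ℝ) (hΔ : 0 ≤ Δ)
    (x : Fin n → ℝ) (hx : x ∈ sparse n k) (w : Fin n → ℝ)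
    (yhat z : Fin n → ℝ)
    (hyhat : ∀ i, yhat i = max (x i - Δ) (min (w i) (x i + Δ)))
    (hz : ∀ i, z i = (w i) ^ 2 - (w i - yhat i) ^ 2)
    (L T : Finset (Fin n))
    (hLdef : L = Finset.univ.filter (fun i => Δ < |x i|))
    (hTL : ∀ i ∈ T, i ∉ L)
    (hTcard : T.card = k - L.card)
    (hTmax : ∀ i ∈ T, ∀ j, j ∉ L → j ∉ T → z j ≤ z i)
    (p : Fin n → ℝ)
    (hp : ∀ i, p i = if i ∈ L ∪ T then yhat i else 0) :
    p ∈ projSet w (sparse n k ∩ box n x Δ) := by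
  have hL (i : Fin n) : i ∈ L ↔ Δ < |x i| := by simp [hLdef]
  have hbox (i : Fin n) : |yhat i - x i| ≤ Δ := hyhat i ▸ abs_clamp_sub_le hΔ
  have hclosest {y : Fin n → ℝ} (hy : y ∈ box n x Δ) (i : Fin n) :
      (w i - yhat i) ^ 2 ≤ (w i - y i) ^ 2 := hyhat i ▸ sq_sub_clamp_le (hy i)
  have hsupp {y : Fin n → ℝ} (hy : y ∈ box n x Δ) {i : Fin n} (hi : i ∈ L) : y i ≠ 0 := by
    intro h0
    have := hy i
    rw [h0, zero_sub, abs_neg] at this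
    exact absurd ((hL i).1 hi) (not_lt.2 this)
  have hLk : L.card ≤ k := by
    refine le_trans (Finset.card_le_card fun i hi => ?_) hx
    exact Finset.mem_filter.2 ⟨Finset.mem_univ i, hsupp (fun j => by simpa using hΔ) hi⟩
  have hScard : (L ∪ T).card = k := by
    rw [Finset.card_union_of_disjoint (Finset.disjoint_left.2 fun i hi hi' => hTL i hi' hi)]
    omega
  have hznonneg {i : Fin n} (hi : i ∉ L) : 0 ≤ z i := by
    have hxi : |0 - x i| ≤ Δ := by simpa using not_lt.1 (mt (hL i).2 hi)
    have := sq_sub_clamp_le (w := w i) hxi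
    rw [← hyhat, sub_zero] at this
    rw [hz]
    linarith
  refine ⟨⟨?_, ?_⟩, ?_⟩
  · refine le_trans (Finset.card_le_card fun i hi => ?_) hScard.le
    by_contra h
    exact (Finset.mem_filter.1 hi).2 (by rw [hp, if_neg h])
  · intro i
    rw [hp]
    split_ifs with h
    · exact hbox i
    · have hi : i ∉ L := fun h' => h (Finset.mem_union_left T h')
      simpa using not_lt.1 (mt (hL i).2 hi)
  · rintro y ⟨hyk, hy⟩
    set U := Finset.univ.filter (fun i => y i ≠ 0) with hU
    have hLU : L ⊆ U := fun i hi => Finset.mem_filter.2 ⟨Finset.mem_univ i, hsupp hy hi⟩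
    have hUk : U.card ≤ (L ∪ T).card := hScard.symm ▸ hyk
    have hsum_sdiff : ∑ i ∈ U \ (L ∪ T), z i ≤ ∑ i ∈ (L ∪ T) \ U, z i := by
      have hB {i : Fin n} (hi : i ∈ (L ∪ T) \ U) : i ∈ T := by
        obtain ⟨h, hiU⟩ := Finset.mem_sdiff.1 hi
        exact (Finset.mem_union.1 h).resolve_left fun h' => hiU (hLU h')
      have hA {i : Fin n} (hi : i ∈ U \ (L ∪ T)) : i ∉ L ∧ i ∉ T := by
        simpa using (Finset.mem_sdiff.1 hi).2
      exact sum_le_sum_of_card_le_of_forall_le (Finset.card_sdiff_le_card_sdiff_iff.2 hUk)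
        (fun i hi => hznonneg (hA hi).1) (fun i hi => hznonneg (hTL i (hB hi)))
        (fun j hj i hi => hTmax i (hB hi) j (hA hj).1 (hA hj).2)
    have hsum : ∑ i ∈ U, z i ≤ ∑ i ∈ L ∪ T, z i := by
      rw [← Finset.sum_inter_add_sum_sdiff U (L ∪ T), ← Finset.sum_inter_add_sum_sdiff (L ∪ T) U,
        Finset.inter_comm]
      gcongr
    calc distSq w p = ∑ i, (w i ^ 2 - if i ∈ L ∪ T then z i else 0) := by
          refine Finset.sum_congr rfl fun i _ => ?_
          rw [hp, hz]
          split_ifs <;> ring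
      _ = ∑ i, w i ^ 2 - ∑ i ∈ L ∪ T, z i := by
          rw [Finset.sum_sub_distrib, Finset.sum_ite_mem, Finset.univ_inter]
      _ ≤ ∑ i, w i ^ 2 - ∑ i ∈ U, z i := by gcongr
      _ = ∑ i, (w i ^ 2 - if i ∈ U then z i else 0) := by
          rw [Finset.sum_sub_distrib, Finset.sum_ite_mem, Finset.univ_inter]
      _ ≤ distSq w y := by
          refine Finset.sum_le_sum fun i _ => ?_
          split_ifs with h
          · rw [hz, sub_sub_cancel]
            exact hclosest hy i
          · have : y i = 0 := by simpa [hU] using h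
            simp [this]
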